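/- Let ρ and σ be 2^n×2^n density matrices. For a coefficient family α : {0,1,2,3}^n → ℂ, λ ≥ 0, and a 2^{n+1}×2^{n+1} density matrix ω, define f(ρ,σ,λ,ω,α) = Tr[ρ²] + Tr[σ²] + λ² Tr[ω²] + 2^{n+1} Σ_{x⃗} |α_{x⃗}|² − 2λ Tr[(|0⟩⟨0| ⊗ ρ)ω] − 2λ Tr[(|1⟩⟨1| ⊗ σ)ω] − 2λ Σ_{x⃗} Re[α_{x⃗} Tr[((σ₁ − i σ₂) ⊗ σ_{x⃗}) ω]]. Then lim_{c→∞} sSup {2^n Re[α_{0⃗}] − c·f(ρ,σ,λ,ω,α) : α : {0,1,2,3}^n → ℂ, λ ≥ 0, ω a 2^{n+1}×2^{n+1} density matrix} = sSup {Re Tr[X] : X a 2^n×2^n complex matrix such that the 2×2 block matrix with blocks [ρ, X†; X, σ] is positive semidefinite}. -/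

import Mathlib

open Matrix Filter
open scoped ComplexOrder Kronecker

noncomputable section

/-- The Hilbert–Schmidt (Frobenius) norm of a complex matrix. -/
def hsNorm {ι : Type*} [Fintype ι] (M : Matrix ι ι ℂ) : ℝ :=
  Real.sqrt ((Mᴴ * M).trace.re)

/-- The single-qubit Pauli matrices σ₀ = I, σ₁ = X, σ₂ = Y, σ₃ = Z. -/
def pauli : Fin 4 → Matrix (Fin 2) (Fin 2) ℂ :=
  ![1, !![0, 1; 1, 0], !![0, -Complex.I; Complex.I, 0], !![1, 0; 0, -1]]

/-- The Pauli string σ_{x⃗} = σ_{x₁} ⊗ ⋯ ⊗ σ_{x_k}, realized entrywise on the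
index type `Fin k → Fin 2` of `k`-bit strings. -/
def pauliString {k : ℕ} (x : Fin k → Fin 4) :
    Matrix (Fin k → Fin 2) (Fin k → Fin 2) ℂ :=
  Matrix.of fun a b => ∏ i, pauli (x i) (a i) (b i)

/-- |0⟩⟨0| as a 2×2 matrix. -/
def ket0bra0 : Matrix (Fin 2) (Fin 2) ℂ := !![1, 0; 0, 0]

/-- |1⟩⟨1| as a 2×2 matrix. -/
def ket1bra1 : Matrix (Fin 2) (Fin 2) ℂ := !![0, 0; 0, 1]

theorem hsNorm_nonneg {ι : Type*} [Fintype ι] (M : Matrix ι ι ℂ) : 0 ≤ hsNorm M :=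
  Real.sqrt_nonneg _

theorem trace_conjTranspose_mul_self_re {ι : Type*} [Fintype ι] (M : Matrix ι ι ℂ) :
    (Mᴴ * M).trace.re = ∑ j, ∑ i, ‖M i j‖ ^ 2 := by
  simp only [trace, diag_apply, mul_apply, conjTranspose_apply, Complex.re_sum]
  refine Finset.sum_congr rfl fun j _ => Finset.sum_congr rfl fun i _ => ?_
  rw [Complex.star_def, ← Complex.normSq_eq_conj_mul_self, Complex.ofReal_re,
    Complex.normSq_eq_norm_sq]

theorem hsNorm_sq {ι : Type*} [Fintype ι] (M : Matrix ι ι ℂ) :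
    hsNorm M ^ 2 = (Mᴴ * M).trace.re := by
  refine Real.sq_sqrt ?_
  rw [trace_conjTranspose_mul_self_re]
  positivity

theorem norm_entry_le_hsNorm {ι : Type*} [Fintype ι] (M : Matrix ι ι ℂ) (i j : ι) :
    ‖M i j‖ ≤ hsNorm M := by
  refine le_of_sq_le_sq ?_ (hsNorm_nonneg M)
  rw [hsNorm_sq, trace_conjTranspose_mul_self_re]
  calc ‖M i j‖ ^ 2 ≤ ∑ i, ‖M i j‖ ^ 2 :=
        Finset.single_le_sum (f := fun i => ‖M i j‖ ^ 2) (fun _ _ => by positivity)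
          (Finset.mem_univ i)
    _ ≤ _ := Finset.single_le_sum (f := fun j => ∑ i, ‖M i j‖ ^ 2)
          (fun _ _ => by positivity) (Finset.mem_univ j)

theorem Matrix.PosSemidef.two_mul_norm_apply_le {ι : Type*} [Fintype ι] {P : Matrix ι ι ℂ}
    (hP : P.PosSemidef) (i j : ι) : 2 * ‖P i j‖ ≤ (P i i).re + (P j j).re := by
  have hdet := (hP.submatrix ![i, j]).det_nonneg
  have hi := Complex.le_def.1 (hP.diag_nonneg (i := i))
  have hj := Complex.le_def.1 (hP.diag_nonneg (i := j))
  have hji : P j i = star (P i j) := (hP.1.apply j i).symm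
  simp only [det_fin_two, submatrix_apply, cons_val_zero, cons_val_one] at hdet
  rw [hji, Complex.star_def, Complex.mul_conj, Complex.normSq_eq_norm_sq] at hdet
  have h := (Complex.le_def.1 hdet).1
  simp only [Complex.zero_re, Complex.zero_im, Complex.sub_re, Complex.mul_re, ← hi.2, ← hj.2,
    Complex.ofReal_re, mul_zero, sub_zero] at h hi hj
  nlinarith [sq_nonneg ((P i i).re - (P j j).re), norm_nonneg (P i j), hi.1, hj.1]

theorem isClosed_setOf_posSemidef {ι : Type*} [Fintype ι] :
    IsClosed {A : Matrix ι ι ℂ | A.PosSemidef} := by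
  simp only [posSemidef_iff_dotProduct_mulVec, Set.ofPred_and, Set.ofPred_forall]
  refine (isClosed_eq (by fun_prop) continuous_id).inter (isClosed_iInter fun x => ?_)
  exact isClosed_le continuous_const (by fun_prop)

theorem Matrix.PosSemidef.fromBlocks_zero {m : Type*} [Fintype m] {ρ σ : Matrix m m ℂ}
    (hρ : ρ.PosSemidef) (hσ : σ.PosSemidef) : (fromBlocks ρ 0 0 σ).PosSemidef := by
  refine .of_dotProduct_mulVec_nonneg (.fromBlocks hρ.1 (by simp) hσ.1) fun x => ?_
  rw [← Sum.elim_comp_inl_inr x, fromBlocks_mulVec]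
  simpa [Matrix.star_sumElim, dotProduct] using
    add_nonneg (hρ.dotProduct_mulVec_nonneg (x ∘ Sum.inl))
      (hσ.dotProduct_mulVec_nonneg (x ∘ Sum.inr))

/-- The value set of the primal semidefinite program for the root fidelity. -/
def fidelityValues {m : Type*} [Fintype m] (ρ σ : Matrix m m ℂ) : Set ℝ :=
  {v | ∃ X : Matrix m m ℂ, (fromBlocks ρ Xᴴ X σ).PosSemidef ∧ v = X.trace.re}

section Penalty

variable {m : Type*} [Fintype m] {ρ σ : Matrix m m ℂ}

theorem zero_mem_fidelityValues (hρ : ρ.PosSemidef) (hσ : σ.PosSemidef) :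
    0 ∈ fidelityValues ρ σ :=
  ⟨0, by simpa using hρ.fromBlocks_zero hσ, by simp⟩

theorem norm_offDiagonal_le (hρ : ρ.PosSemidef) (hσ : σ.PosSemidef) (X : Matrix m m ℂ)
    {P : Matrix (m ⊕ m) (m ⊕ m) ℂ} (hP : P.PosSemidef) (a b : m) :
    ‖X a b‖ ≤ ρ.trace.re + σ.trace.re + 2 * hsNorm (fromBlocks ρ Xᴴ X σ - P) := by
  set D := fromBlocks ρ Xᴴ X σ - P with hD
  have hX : X a b = D (.inr a) (.inl b) + P (.inr a) (.inl b) := by simp [hD]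
  have hPσ : P (.inr a) (.inr a) = σ a a - D (.inr a) (.inr a) := by simp [hD]
  have hPρ : P (.inl b) (.inl b) = ρ b b - D (.inl b) (.inl b) := by simp [hD]
  have hdiag : ∀ {τ : Matrix m m ℂ}, τ.PosSemidef → ∀ i, (τ i i).re ≤ τ.trace.re := by
    intro τ hτ i
    rw [trace, Complex.re_sum]
    exact Finset.single_le_sum (f := fun i => (τ i i).re)
      (fun j _ => (Complex.le_def.1 (hτ.diag_nonneg (i := j))).1) (Finset.mem_univ i)
  have hre : ∀ i, -(D i i).re ≤ hsNorm D := fun i =>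
    (neg_le_abs _).trans ((Complex.abs_re_le_norm _).trans (norm_entry_le_hsNorm D i i))
  have h := hP.two_mul_norm_apply_le (.inr a) (.inl b)
  rw [hPσ, hPρ, Complex.sub_re, Complex.sub_re] at h
  have hnorm := norm_add_le (D (.inr a) (.inl b)) (P (.inr a) (.inl b))
  rw [← hX] at hnorm
  have hρ0 : 0 ≤ ρ.trace.re := (Complex.le_def.1 hρ.trace_nonneg).1
  have hσ0 : 0 ≤ σ.trace.re := (Complex.le_def.1 hσ.trace_nonneg).1
  linarith [norm_entry_le_hsNorm D (.inr a) (.inl b), hdiag hρ b, hdiag hσ a, hre (.inr a),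
    hre (.inl b)]

theorem re_trace_offDiagonal_le (hρ : ρ.PosSemidef) (hσ : σ.PosSemidef) (X : Matrix m m ℂ)
    {P : Matrix (m ⊕ m) (m ⊕ m) ℂ} (hP : P.PosSemidef) :
    X.trace.re ≤ Fintype.card m *
      (ρ.trace.re + σ.trace.re + 2 * hsNorm (fromBlocks ρ Xᴴ X σ - P)) := by
  rw [trace, Complex.re_sum, ← nsmul_eq_mul]
  exact Finset.sum_le_card_nsmul _ _ _ fun a _ =>
    (Complex.re_le_norm _).trans (norm_offDiagonal_le hρ hσ X hP a a)

theorem bddAbove_fidelityValues (hρ : ρ.PosSemidef) (hσ : σ.PosSemidef) :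
    BddAbove (fidelityValues ρ σ) := by
  refine ⟨Fintype.card m * (ρ.trace.re + σ.trace.re), ?_⟩
  rintro _ ⟨X, hX, rfl⟩
  simpa [hsNorm] using re_trace_offDiagonal_le hρ hσ X hX

/-- A quadratic penalty with a large coefficient enforces the semidefinite constraint up to
an arbitrarily small error in the objective value. -/
theorem exists_penalty_le (hρ : ρ.PosSemidef) (hσ : σ.PosSemidef) {ε : ℝ} (hε : 0 < ε) :
    ∃ C : ℝ, ∀ c ≥ C, ∀ (X : Matrix m m ℂ) (P : Matrix (m ⊕ m) (m ⊕ m) ℂ), P.PosSemidef →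
      X.trace.re - c * hsNorm (fromBlocks ρ Xᴴ X σ - P) ^ 2 ≤ sSup (fidelityValues ρ σ) + ε := by
  by_contra! hcon
  set d : ℝ := (Fintype.card m : ℝ)
  set B : ℝ := ρ.trace.re + σ.trace.re
  have hd : 0 ≤ d := Nat.cast_nonneg _
  have hB : 0 ≤ B := add_nonneg (Complex.le_def.1 hρ.trace_nonneg).1
    (Complex.le_def.1 hσ.trace_nonneg).1
  have hS : 0 ≤ sSup (fidelityValues ρ σ) :=
    le_csSup (bddAbove_fidelityValues hρ hσ) (zero_mem_fidelityValues hρ hσ)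
  choose c hc X P hP hlt using fun j : ℕ => hcon (d + 1 + j)
  set h : ℕ → ℝ := fun j => hsNorm (fromBlocks ρ (X j)ᴴ (X j) σ - P j)
  have hh0 : ∀ j, 0 ≤ h j := fun j => hsNorm_nonneg _
  have hhle : ∀ j : ℕ, h j ^ 2 ≤ d * (B + 1) * (1 / ((j : ℝ) + 1)) := by
    intro j
    have h1 : (X j).trace.re ≤ d * (B + 2 * h j) := re_trace_offDiagonal_le hρ hσ (X j) (hP j)
    have h2 : (d + 1 + j) * h j ^ 2 ≤ c j * h j ^ 2 :=
      mul_le_mul_of_nonneg_right (hc j) (sq_nonneg _)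
    have h3 : sSup (fidelityValues ρ σ) + ε < (X j).trace.re - c j * h j ^ 2 := hlt j
    rw [mul_one_div, le_div_iff₀ (by positivity)]
    nlinarith [mul_nonneg hd (sq_nonneg (h j - 1))]
  have hh : Tendsto h atTop (nhds 0) := by
    have hsq : Tendsto (fun j => h j ^ 2) atTop (nhds 0) :=
      squeeze_zero (fun j => sq_nonneg _) hhle
        (by simpa using tendsto_one_div_add_atTop_nhds_zero_nat.const_mul (d * (B + 1)))
    simpa [Real.sqrt_sq, hh0] using hsq.sqrt
  obtain ⟨R, hR⟩ := hh.bddAbove_range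
  have hmem : ∀ j, (X j : m → m → ℂ) ∈ Set.univ.pi fun _ : m => Set.univ.pi fun _ : m =>
      Metric.closedBall (0 : ℂ) (B + 2 * R) := by
    intro j a _ b _
    rw [mem_closedBall_zero_iff]
    have := hR ⟨j, rfl⟩
    have := norm_offDiagonal_le hρ hσ (X j) (hP j) a b
    change _ ≤ B + 2 * h j at this
    linarith
  obtain ⟨Y, -, φ, hφ, hY⟩ := (isCompact_univ_pi fun _ : m => isCompact_univ_pi fun _ : m =>
    isCompact_closedBall (0 : ℂ) (B + 2 * R)).tendsto_subseq hmem
  replace hY : Tendsto (fun k => X (φ k)) atTop (nhds (Matrix.of Y)) := hY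
  have hW : Tendsto (fun k => fromBlocks ρ (X (φ k))ᴴ (X (φ k)) σ) atTop
      (nhds (fromBlocks ρ (Matrix.of Y)ᴴ (Matrix.of Y) σ)) :=
    ((by fun_prop : Continuous fun Z : Matrix m m ℂ => fromBlocks ρ Zᴴ Z σ).tendsto _).comp hY
  have hDiff : Tendsto (fun k => fromBlocks ρ (X (φ k))ᴴ (X (φ k)) σ - P (φ k)) atTop
      (nhds 0) := by
    refine tendsto_pi_nhds.2 fun i => tendsto_pi_nhds.2 fun j => ?_
    exact squeeze_zero_norm (fun k => norm_entry_le_hsNorm _ i j) (hh.comp hφ.tendsto_atTop)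
  have hPW : Tendsto (fun k => P (φ k)) atTop
      (nhds (fromBlocks ρ (Matrix.of Y)ᴴ (Matrix.of Y) σ)) := by
    simpa using hW.sub hDiff
  have hfeas := isClosed_setOf_posSemidef.mem_of_tendsto hPW (.of_forall fun k => hP (φ k))
  have hle : (Matrix.of Y).trace.re ≤ sSup (fidelityValues ρ σ) :=
    le_csSup (bddAbove_fidelityValues hρ hσ) ⟨_, hfeas, rfl⟩
  have htr : Tendsto (fun k => (X (φ k)).trace.re) atTop (nhds (Matrix.of Y).trace.re) :=
    ((by fun_prop : Continuous fun Z : Matrix m m ℂ => Z.trace.re).tendsto _).comp hY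
  have hge := ge_of_tendsto' htr fun k => by
    have hcpos : 0 ≤ c (φ k) := le_trans (by positivity) (hc (φ k))
    have := hlt (φ k)
    have := mul_nonneg hcpos (sq_nonneg (h (φ k)))
    change _ ≤ (X (φ k)).trace.re
    exact le_of_lt (by linarith : sSup (fidelityValues ρ σ) + ε < _)
  linarith

end Penalty

theorem pauli_zero : pauli 0 = !![1, 0; 0, 1] := one_fin_two

theorem pauli_one : pauli 1 = !![0, 1; 1, 0] := rfl

theorem pauli_two : pauli 2 = !![0, -Complex.I; Complex.I, 0] := rfl

theorem pauli_three : pauli 3 = !![1, 0; 0, -1] := rfl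

theorem sum_pauli_apply_mul_pauli_apply (a b c d : Fin 2) :
    ∑ x, pauli x a b * pauli x c d = if c = b ∧ d = a then 2 else 0 := by
  fin_cases a <;> fin_cases b <;> fin_cases c <;> fin_cases d <;>
    norm_num [Fin.sum_univ_four, pauli_zero, pauli_one, pauli_two, pauli_three]

theorem sum_star_pauli_mul_pauli (x y : Fin 4) :
    ∑ b, ∑ a, star (pauli x a b) * pauli y a b = if x = y then 2 else 0 := by
  fin_cases x <;> fin_cases y <;>
    simp [Fin.sum_univ_two, pauli_zero, pauli_one, pauli_two, pauli_three, one_add_one_eq_two]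

theorem trace_pauli (x : Fin 4) : (pauli x).trace = if x = 0 then 2 else 0 := by
  fin_cases x <;>
    simp [trace_fin_two, pauli_zero, pauli_one, pauli_two, pauli_three, one_add_one_eq_two]

theorem trace_pauliString {n : ℕ} (x : Fin n → Fin 4) :
    (pauliString x).trace = if x = fun _ => 0 then 2 ^ n else 0 := by
  have h : (pauliString x).trace = ∏ i, (pauli (x i)).trace := by
    simp only [trace, diag_apply, pauliString, of_apply, Fintype.prod_sum]
  simp only [h, trace_pauli, Finset.prod_ite_zero, funext_iff, Finset.mem_univ, true_imp_iff,
    Finset.prod_const, Finset.card_univ, Fintype.card_fin]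

theorem trace_pauliString_conjTranspose_mul {n : ℕ} (x y : Fin n → Fin 4) :
    ((pauliString x)ᴴ * pauliString y).trace = if x = y then 2 ^ n else 0 := by
  have h : ((pauliString x)ᴴ * pauliString y).trace =
      ∏ i, ∑ b, ∑ a, star (pauli (x i) a b) * pauli (y i) a b := by
    simp only [trace, diag_apply, mul_apply, conjTranspose_apply, pauliString, of_apply,
      Fintype.prod_sum, star_prod, Finset.prod_mul_distrib]
  simp only [h, sum_star_pauli_mul_pauli, Finset.prod_ite_zero, funext_iff, Finset.mem_univ,
    true_imp_iff, Finset.prod_const, Finset.card_univ, Fintype.card_fin]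

theorem sum_pauliString_apply_mul {n : ℕ} (a b c d : Fin n → Fin 2) :
    ∑ x, pauliString x a b * pauliString x c d = if c = b ∧ d = a then 2 ^ n else 0 := by
  have h : ∑ x, pauliString x a b * pauliString x c d =
      ∏ i, ∑ x, pauli x (a i) (b i) * pauli x (c i) (d i) := by
    simp only [pauliString, of_apply, Fintype.prod_sum, Finset.prod_mul_distrib]
  simp only [h, sum_pauli_apply_mul_pauli_apply, Finset.prod_ite_zero, funext_iff,
    Finset.mem_univ, true_imp_iff, Finset.prod_const, Finset.card_univ, Fintype.card_fin,
    forall_and]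

theorem trace_sum_smul_pauliString {n : ℕ} (α : (Fin n → Fin 4) → ℂ) :
    (∑ x, α x • pauliString x).trace = 2 ^ n * α fun _ => 0 := by
  simp [trace_sum, trace_pauliString, mul_comm]

theorem trace_conjTranspose_mul_sum_smul_pauliString {n : ℕ} (α : (Fin n → Fin 4) → ℂ) :
    ((∑ x, α x • pauliString x)ᴴ * ∑ x, α x • pauliString x).trace.re =
      2 ^ n * ∑ x, Complex.normSq (α x) := by
  have h : ((∑ x, α x • pauliString x)ᴴ * ∑ x, α x • pauliString x).trace =
      ((2 ^ n * ∑ x, Complex.normSq (α x) : ℝ) : ℂ) := by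
    rw [conjTranspose_sum, Finset.sum_mul_sum]
    simp only [trace_sum, conjTranspose_smul, smul_mul_assoc, mul_smul_comm, trace_smul,
      smul_eq_mul, trace_pauliString_conjTranspose_mul, mul_ite, mul_zero, Finset.sum_ite_eq,
      Finset.mem_univ, if_true, Finset.mul_sum]
    push_cast
    refine Finset.sum_congr rfl fun x _ => ?_
    rw [Complex.normSq_eq_conj_mul_self, Complex.star_def]
    ring
  rw [h, Complex.ofReal_re]

theorem exists_sum_smul_pauliString_eq {n : ℕ} (X : Matrix (Fin n → Fin 2) (Fin n → Fin 2) ℂ) :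
    ∃ α : (Fin n → Fin 4) → ℂ, ∑ x, α x • pauliString x = X := by
  refine ⟨fun x => (2 ^ n)⁻¹ * ∑ c, ∑ d, X d c * pauliString x c d, ?_⟩
  ext a b
  have h : ∀ x, (2 ^ n)⁻¹ * (∑ c, ∑ d, X d c * pauliString x c d) * pauliString x a b =
      ∑ c, ∑ d, (2 ^ n)⁻¹ * X d c * (pauliString x a b * pauliString x c d) := by
    intro x
    simp only [Finset.mul_sum, Finset.sum_mul]
    exact Finset.sum_congr rfl fun c _ => Finset.sum_congr rfl fun d _ => by ring
  simp only [Matrix.sum_apply, Matrix.smul_apply, smul_eq_mul, h]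
  rw [Finset.sum_comm]
  simp only [Finset.sum_comm (s := (Finset.univ : Finset (Fin n → Fin 4)))]
  simp only [← Finset.mul_sum, sum_pauliString_apply_mul]
  simp only [ite_and, mul_ite, mul_zero, Finset.sum_ite_irrel, Finset.sum_ite_eq',
    Finset.sum_const_zero, Finset.mem_univ, if_true]
  field_simp

section Blocks

variable {m : Type*}

/-- A pair of a qubit index and an index in `m` as an index of a two-by-two block matrix. -/
def qubitProdEquivSum (m : Type*) : Fin 2 × m ≃ m ⊕ m :=
  (finTwoEquiv.prodCongr (Equiv.refl m)).trans (Equiv.boolProdEquivSum m)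

theorem submatrix_qubitProdEquivSum_symm (ω : Matrix (Fin 2 × m) (Fin 2 × m) ℂ) :
    ω.submatrix (qubitProdEquivSum m).symm (qubitProdEquivSum m).symm =
      fromBlocks (ω.submatrix (Prod.mk 0) (Prod.mk 0)) (ω.submatrix (Prod.mk 0) (Prod.mk 1))
        (ω.submatrix (Prod.mk 1) (Prod.mk 0)) (ω.submatrix (Prod.mk 1) (Prod.mk 1)) := by
  ext (i | i) (j | j) <;> rfl

variable [Fintype m]

theorem Matrix.trace_fromBlocks (A B C D : Matrix m m ℂ) :
    (fromBlocks A B C D).trace = A.trace + D.trace := by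
  simp [trace]

theorem trace_kronecker_mul (A : Matrix (Fin 2) (Fin 2) ℂ) (B : Matrix m m ℂ)
    (ω : Matrix (Fin 2 × m) (Fin 2 × m) ℂ) :
    ((A ⊗ₖ B) * ω).trace =
      ∑ i, ∑ j, A i j * (B * ω.submatrix (Prod.mk j) (Prod.mk i)).trace := by
  simp only [trace, diag_apply, mul_apply, Fintype.sum_prod_type, kroneckerMap_apply,
    submatrix_apply, Finset.mul_sum]
  refine Finset.sum_congr rfl fun i _ => ?_
  rw [Finset.sum_comm]
  simp only [mul_assoc]

theorem hsNorm_sub_smul_sq {ι : Type*} [Fintype ι] {A B : Matrix ι ι ℂ} (hA : A.IsHermitian)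
    (hB : B.IsHermitian) (r : ℝ) :
    hsNorm (A - r • B) ^ 2 =
      (A * A).trace.re + r ^ 2 * (B * B).trace.re - 2 * r * (A * B).trace.re := by
  have hH : (A - r • B)ᴴ = A - r • B := by simp [hA.eq, hB.eq]
  rw [hsNorm_sq, hH]
  simp only [sub_mul, mul_sub, smul_mul_assoc, mul_smul_comm, trace_sub, trace_smul,
    Complex.sub_re, Complex.smul_re, smul_eq_mul, trace_mul_comm B A]
  ring

theorem trace_fromBlocks_mul_self_re (ρ σ X : Matrix m m ℂ) :
    (fromBlocks ρ Xᴴ X σ * fromBlocks ρ Xᴴ X σ).trace.re =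
      (ρ * ρ).trace.re + (σ * σ).trace.re + 2 * (Xᴴ * X).trace.re := by
  simp only [fromBlocks_multiply, Matrix.trace_fromBlocks, trace_add, Complex.add_re,
    trace_mul_comm X Xᴴ]
  ring

theorem trace_fromBlocks_mul_submatrix_re (ρ σ X : Matrix m m ℂ)
    {ω : Matrix (Fin 2 × m) (Fin 2 × m) ℂ} (hω : ω.IsHermitian) :
    (fromBlocks ρ Xᴴ X σ *
        ω.submatrix (qubitProdEquivSum m).symm (qubitProdEquivSum m).symm).trace.re =
      ((ket0bra0 ⊗ₖ ρ) * ω).trace.re + ((ket1bra1 ⊗ₖ σ) * ω).trace.re +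
        (((pauli 1 - Complex.I • pauli 2) ⊗ₖ X) * ω).trace.re := by
  have h : (Xᴴ * ω.submatrix (Prod.mk 1) (Prod.mk 0)).trace.re =
      (X * ω.submatrix (Prod.mk 0) (Prod.mk 1)).trace.re := by
    rw [← Complex.conj_re, ← Complex.star_def, ← trace_conjTranspose, conjTranspose_mul,
      conjTranspose_conjTranspose, conjTranspose_submatrix, hω.eq, trace_mul_comm]
  rw [submatrix_qubitProdEquivSum_symm, fromBlocks_multiply]
  simp only [trace_kronecker_mul, Matrix.trace_fromBlocks, trace_add, Complex.add_re, h]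
  norm_num [ket0bra0, ket1bra1, pauli_one, pauli_two, Fin.sum_univ_two]
  ring

end Blocks

theorem qslack_penalty_eq {n : ℕ} {ρ σ : Matrix (Fin n → Fin 2) (Fin n → Fin 2) ℂ}
    (hρ : ρ.IsHermitian) (hσ : σ.IsHermitian) (α : (Fin n → Fin 4) → ℂ) (lam : ℝ)
    {ω : Matrix (Fin 2 × (Fin n → Fin 2)) (Fin 2 × (Fin n → Fin 2)) ℂ} (hω : ω.IsHermitian) :
    (((ρ * ρ).trace.re) + ((σ * σ).trace.re) + lam^2 * ((ω * ω).trace.re)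
              + (2:ℝ)^(n+1) * ∑ x, Complex.normSq (α x)
              - 2 * lam * (((ket0bra0 ⊗ₖ ρ) * ω).trace.re)
              - 2 * lam * (((ket1bra1 ⊗ₖ σ) * ω).trace.re)
              - 2 * lam * ∑ x, (α x *
                  (((pauli 1 - Complex.I • pauli 2) ⊗ₖ pauliString x) * ω).trace).re) =
      hsNorm (fromBlocks ρ (∑ x, α x • pauliString x)ᴴ (∑ x, α x • pauliString x) σ -
        lam • ω.submatrix (qubitProdEquivSum _).symm (qubitProdEquivSum _).symm) ^ 2 := by
  have hcross : (((pauli 1 - Complex.I • pauli 2) ⊗ₖ ∑ x, α x • pauliString x) * ω).trace.re =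
      ∑ x, (α x * (((pauli 1 - Complex.I • pauli 2) ⊗ₖ pauliString x) * ω).trace).re := by
    simp only [trace_kronecker_mul, Finset.sum_mul, trace_sum, smul_mul_assoc, trace_smul,
      smul_eq_mul, Finset.mul_sum, ← Complex.re_sum, Fin.sum_univ_two, Finset.sum_add_distrib]
    congr 1
    simp only [mul_add, Finset.sum_add_distrib, mul_left_comm]
  rw [hsNorm_sub_smul_sq (.fromBlocks hρ (by simp) hσ) (hω.submatrix _),
    trace_fromBlocks_mul_self_re, trace_fromBlocks_mul_submatrix_re _ _ _ hω,
    trace_conjTranspose_mul_sum_smul_pauliString, hcross, submatrix_mul_equiv]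
  have htr : ((ω * ω).submatrix (qubitProdEquivSum (Fin n → Fin 2)).symm
      (qubitProdEquivSum _).symm).trace = (ω * ω).trace :=
    Equiv.sum_comp (qubitProdEquivSum _).symm fun i => (ω * ω) i i
  rw [htr]
  ring

theorem root_fidelity_primal_qslack (n : ℕ)
    (ρ σ : Matrix (Fin n → Fin 2) (Fin n → Fin 2) ℂ)
    (hρ : ρ.PosSemidef ∧ ρ.trace = 1) (hσ : σ.PosSemidef ∧ σ.trace = 1) :
    Tendsto (fun c : ℝ =>
        sSup {v : ℝ | ∃ (α : (Fin n → Fin 4) → ℂ) (lam : ℝ)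
            (ω : Matrix (Fin 2 × (Fin n → Fin 2)) (Fin 2 × (Fin n → Fin 2)) ℂ),
          0 ≤ lam ∧ ω.PosSemidef ∧ ω.trace = 1 ∧
          v = (2:ℝ)^n * (α (fun _ => 0)).re - c *
            (((ρ * ρ).trace.re) + ((σ * σ).trace.re) + lam^2 * ((ω * ω).trace.re)
              + (2:ℝ)^(n+1) * ∑ x, Complex.normSq (α x)
              - 2 * lam * (((ket0bra0 ⊗ₖ ρ) * ω).trace.re)
              - 2 * lam * (((ket1bra1 ⊗ₖ σ) * ω).trace.re)
              - 2 * lam * ∑ x, (α x *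
                  (((pauli 1 - Complex.I • pauli 2) ⊗ₖ pauliString x) * ω).trace).re)})
      atTop
      (nhds (sSup {v : ℝ | ∃ X : Matrix (Fin n → Fin 2) (Fin n → Fin 2) ℂ,
        (Matrix.fromBlocks ρ Xᴴ X σ).PosSemidef ∧ v = X.trace.re})) := by
  have hbd := bddAbove_fidelityValues hρ.1 hσ.1
  change Tendsto _ _ (nhds (sSup (fidelityValues ρ σ)))
  have hfeasible : ∀ v ∈ fidelityValues ρ σ, ∃ (α : (Fin n → Fin 4) → ℂ) (lam : ℝ)
      (ω : Matrix (Fin 2 × (Fin n → Fin 2)) (Fin 2 × (Fin n → Fin 2)) ℂ),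
      0 ≤ lam ∧ ω.PosSemidef ∧ ω.trace = 1 ∧ v = (2:ℝ)^n * (α (fun _ => 0)).re ∧
      hsNorm (fromBlocks ρ (∑ x, α x • pauliString x)ᴴ (∑ x, α x • pauliString x) σ -
        lam • ω.submatrix (qubitProdEquivSum _).symm (qubitProdEquivSum _).symm) ^ 2 = 0 := by
    rintro _ ⟨X, hX, rfl⟩
    obtain ⟨α, rfl⟩ := exists_sum_smul_pauliString_eq X
    refine ⟨α, 2, (2⁻¹ : ℝ) • (fromBlocks ρ (∑ x, α x • pauliString x)ᴴ
      (∑ x, α x • pauliString x) σ).submatrix (qubitProdEquivSum _) (qubitProdEquivSum _),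
      by norm_num, (hX.submatrix _).smul (by norm_num), ?_, ?_, ?_⟩
    · have htr : ((fromBlocks ρ (∑ x, α x • pauliString x)ᴴ (∑ x, α x • pauliString x)
          σ).submatrix (qubitProdEquivSum (Fin n → Fin 2)) (qubitProdEquivSum _)).trace = 2 := by
        rw [show (2 : ℂ) = ρ.trace + σ.trace by rw [hρ.2, hσ.2]; norm_num, ← trace_fromBlocks]
        exact Equiv.sum_comp (qubitProdEquivSum _) fun i => fromBlocks ρ _ _ σ i i
      rw [trace_smul, htr]
      norm_num
    · rw [trace_sum_smul_pauliString]
      simp [← Complex.ofReal_ofNat, ← Complex.ofReal_pow]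
    · rw [submatrix_smul, Pi.smul_apply, Pi.smul_apply, submatrix_submatrix, Equiv.self_comp_symm,
        submatrix_id_id, smul_smul]
      norm_num [hsNorm]
  refine Metric.tendsto_atTop.2 fun ε hε => ?_
  obtain ⟨C, hC⟩ := exists_penalty_le hρ.1 hσ.1 (half_pos hε)
  refine ⟨C, fun c hc => ?_⟩
  set V := {v : ℝ | ∃ (α : (Fin n → Fin 4) → ℂ) (lam : ℝ)
            (ω : Matrix (Fin 2 × (Fin n → Fin 2)) (Fin 2 × (Fin n → Fin 2)) ℂ),
          0 ≤ lam ∧ ω.PosSemidef ∧ ω.trace = 1 ∧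
          v = (2:ℝ)^n * (α (fun _ => 0)).re - c *
            (((ρ * ρ).trace.re) + ((σ * σ).trace.re) + lam^2 * ((ω * ω).trace.re)
              + (2:ℝ)^(n+1) * ∑ x, Complex.normSq (α x)
              - 2 * lam * (((ket0bra0 ⊗ₖ ρ) * ω).trace.re)
              - 2 * lam * (((ket1bra1 ⊗ₖ σ) * ω).trace.re)
              - 2 * lam * ∑ x, (α x *
                  (((pauli 1 - Complex.I • pauli 2) ⊗ₖ pauliString x) * ω).trace).re)}
  have hV : ∀ v ∈ V, v ≤ sSup (fidelityValues ρ σ) + ε / 2 := by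
    rintro _ ⟨α, lam, ω, hlam, hω, -, rfl⟩
    rw [qslack_penalty_eq hρ.1.1 hσ.1.1 α lam hω.1]
    convert hC c hc (∑ x, α x • pauliString x) _ ((hω.submatrix _).smul hlam) using 2
    rw [trace_sum_smul_pauliString]
    simp [← Complex.ofReal_ofNat, ← Complex.ofReal_pow]
  have hsub : fidelityValues ρ σ ⊆ V := by
    intro v hv
    obtain ⟨α, lam, ω, hlam, hω, htr, hval, hzero⟩ := hfeasible v hv
    refine ⟨α, lam, ω, hlam, hω, htr, ?_⟩
    rw [qslack_penalty_eq hρ.1.1 hσ.1.1 α lam hω.1, hzero, hval, mul_zero, sub_zero]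
  have hne : (fidelityValues ρ σ).Nonempty := ⟨0, zero_mem_fidelityValues hρ.1 hσ.1⟩
  have hle : sSup V ≤ sSup (fidelityValues ρ σ) + ε / 2 := csSup_le (hne.mono hsub) hV
  have hge : sSup (fidelityValues ρ σ) ≤ sSup V := csSup_le_csSup ⟨_, hV⟩ hne hsub
  rw [Real.dist_eq, abs_lt]
  constructor <;> linarith
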